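/- Suppose the matrix A together with γ̄ satisfies Assumption 2 and X(t) is generated by the algorithm X(t+1) = P_{γ̄}(A X(t)) from X₀ ∈ S(n,d,γ̄). If there exists a unit (column) vector h ∈ ℝ^d such that the vector X₀hᵀ ∈ ℝⁿ has all entries nonnegative and is not the zero vector, then v(X₀)X₀ ≠ 0 (where v(X₀) is the strictly positive unit vector to which all Euclidean-normalized rows of Ã(k,t₀,X₀) converge), and consequently asymptotic consensus of directions with point-wise convergence holds. -/

import Mathlib

open Finset Filter Topology Matrix

noncomputable def euclNorm {d : ℕ} (x : Fin d → ℝ) : ℝ := Real.sqrt (∑ j, x j ^ 2)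

def unitSphere (d : ℕ) : Set (Fin d → ℝ) := {x | euclNorm x = 1}

/-- A directional function on `S^{d-1}`: continuous and bounded above and below
by positive constants on the unit sphere. -/
def IsDirectional {d : ℕ} (γ : (Fin d → ℝ) → ℝ) : Prop :=
  ContinuousOn γ (unitSphere d) ∧
    ∃ c C : ℝ, 0 < c ∧ ∀ x ∈ unitSphere d, c ≤ γ x ∧ γ x ≤ C

/-- The star boundary `S^{d-1}_γ = {γ(x) x : x ∈ S^{d-1}}`. -/
def starBoundary {d : ℕ} (γ : (Fin d → ℝ) → ℝ) : Set (Fin d → ℝ) :=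
  {y | ∃ x ∈ unitSphere d, y = γ x • x}

/-- `S(n,d,γ̄)`: matrices whose `i`-th row lies on the star boundary of `γ_i`. -/
def Sset (n d : ℕ) (γbar : Fin n → (Fin d → ℝ) → ℝ) : Set (Matrix (Fin n) (Fin d) ℝ) :=
  {X | ∀ i, X i ∈ starBoundary (γbar i)}

/-- Radial projection `P_γ(y) = γ(y/‖y‖₂) · y/‖y‖₂`. -/
noncomputable def radialProj {d : ℕ} (γ : (Fin d → ℝ) → ℝ) (y : Fin d → ℝ) : Fin d → ℝ :=
  γ ((euclNorm y)⁻¹ • y) • ((euclNorm y)⁻¹ • y)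

/-- Row-wise radial projection. -/
noncomputable def rowProj {n d : ℕ} (γbar : Fin n → (Fin d → ℝ) → ℝ)
    (B : Matrix (Fin n) (Fin d) ℝ) : Matrix (Fin n) (Fin d) ℝ :=
  Matrix.of fun i => radialProj (γbar i) (B i)

/-- Assumption 2: each `γ_i` is directional, `A` is a nonnegative weight matrix of a strongly
connected digraph, and the diagonal-dominance condition
`a_ii · min γ_i > Σ_{j≠i} a_ij · max γ_j` holds. -/
def Assumption2 {n d : ℕ} (A : Matrix (Fin n) (Fin n) ℝ)
    (γbar : Fin n → (Fin d → ℝ) → ℝ) : Prop :=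
  (∀ i, IsDirectional (γbar i)) ∧
  (∃ E : Fin n → Fin n → Prop,
    (∀ i j, E i j → 0 < A i j) ∧ (∀ i j, ¬ E i j → A i j = 0) ∧
    (∀ i j, Relation.ReflTransGen E i j)) ∧
  (∀ i, (∑ j ∈ Finset.univ.erase i, A i j * sSup (γbar j '' unitSphere d)) <
      A i i * sInf (γbar i '' unitSphere d))

/-- The trajectory of the algorithm `X(t+1) = P_γ̄(A X(t))`, indexed by `k = t - t₀`. -/
noncomputable def traj {n d : ℕ} (A : Matrix (Fin n) (Fin n) ℝ)
    (γbar : Fin n → (Fin d → ℝ) → ℝ) (X₀ : Matrix (Fin n) (Fin d) ℝ) :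
    ℕ → Matrix (Fin n) (Fin d) ℝ
  | 0 => X₀
  | k + 1 => rowProj γbar (A * traj A γbar X₀ k)

/-- `D_γ̄(B)`: diagonal matrix with entries `γ_i([B]_i/‖[B]_i‖₂)/‖[B]_i‖₂`. -/
noncomputable def Dmat {n d : ℕ} (γbar : Fin n → (Fin d → ℝ) → ℝ)
    (B : Matrix (Fin n) (Fin d) ℝ) : Matrix (Fin n) (Fin n) ℝ :=
  Matrix.diagonal fun i => γbar i ((euclNorm (B i))⁻¹ • B i) / euclNorm (B i)

/-- The product matrices `Ã(k,t₀,X₀) = D_γ̄(A X(t₀+k−1))A ⋯ D_γ̄(A X(t₀))A`. -/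
noncomputable def Atilde {n d : ℕ} (A : Matrix (Fin n) (Fin n) ℝ)
    (γbar : Fin n → (Fin d → ℝ) → ℝ) (X₀ : Matrix (Fin n) (Fin d) ℝ) :
    ℕ → Matrix (Fin n) (Fin n) ℝ
  | 0 => 1
  | k + 1 => Dmat γbar (A * traj A γbar X₀ k) * A * Atilde A γbar X₀ k

/-- `v` is the strictly positive unit vector to which all Euclidean-normalized rows of
`Ã(k,t₀,X₀)` converge. -/
def IsLimitVec {n d : ℕ} (A : Matrix (Fin n) (Fin n) ℝ)
    (γbar : Fin n → (Fin d → ℝ) → ℝ) (X₀ : Matrix (Fin n) (Fin d) ℝ)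
    (v : Fin n → ℝ) : Prop :=
  euclNorm v = 1 ∧ (∀ i, 0 < v i) ∧
    ∀ i, Tendsto (fun k => (euclNorm (Atilde A γbar X₀ k i))⁻¹ • Atilde A γbar X₀ k i)
      atTop (𝓝 v)

/-- Asymptotic consensus of directions. -/
def ConsensusDir {n d : ℕ} (X : ℕ → Matrix (Fin n) (Fin d) ℝ) : Prop :=
  ∀ i j, Tendsto
    (fun t => euclNorm ((euclNorm (X t i))⁻¹ • X t i - (euclNorm (X t j))⁻¹ • X t j))
    atTop (𝓝 0)

/-- Asymptotic consensus of directions with point-wise convergence to a unit vector. -/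
def ConsensusPW {n d : ℕ} (X : ℕ → Matrix (Fin n) (Fin d) ℝ) : Prop :=
  ∃ u : Fin d → ℝ, euclNorm u = 1 ∧
    ∀ i, Tendsto (fun t => (euclNorm (X t i))⁻¹ • X t i) atTop (𝓝 u)

theorem euclNorm_nonneg {d : ℕ} (x : Fin d → ℝ) : 0 ≤ euclNorm x := Real.sqrt_nonneg _

theorem euclNorm_eq_zero {d : ℕ} {x : Fin d → ℝ} : euclNorm x = 0 ↔ x = 0 := by
  rw [euclNorm, Real.sqrt_eq_zero (Finset.sum_nonneg fun j _ => sq_nonneg (x j)),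
    Finset.sum_eq_zero_iff_of_nonneg fun j _ => sq_nonneg (x j)]
  simp [funext_iff]

theorem euclNorm_pos {d : ℕ} {x : Fin d → ℝ} (hx : x ≠ 0) : 0 < euclNorm x :=
  lt_of_le_of_ne (euclNorm_nonneg x) fun h => hx (euclNorm_eq_zero.1 h.symm)

theorem euclNorm_smul {d : ℕ} (c : ℝ) (x : Fin d → ℝ) :
    euclNorm (c • x) = |c| * euclNorm x := by
  simp only [euclNorm, Pi.smul_apply, smul_eq_mul, mul_pow, ← Finset.mul_sum]
  rw [Real.sqrt_mul (sq_nonneg c), Real.sqrt_sq_eq_abs]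

theorem continuous_euclNorm {d : ℕ} : Continuous (euclNorm : (Fin d → ℝ) → ℝ) := by
  unfold euclNorm
  fun_prop

theorem euclNorm_normalize {d : ℕ} {x : Fin d → ℝ} (hx : x ≠ 0) :
    euclNorm ((euclNorm x)⁻¹ • x) = 1 := by
  rw [euclNorm_smul, abs_of_nonneg (inv_nonneg.2 (euclNorm_nonneg x)),
    inv_mul_cancel₀ (euclNorm_pos hx).ne']

theorem normalize_smul {d : ℕ} {c : ℝ} (hc : 0 < c) (x : Fin d → ℝ) :
    (euclNorm (c • x))⁻¹ • (c • x) = (euclNorm x)⁻¹ • x := by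
  rw [euclNorm_smul, abs_of_pos hc, smul_smul, mul_inv, mul_right_comm,
    inv_mul_cancel₀ hc.ne', one_mul]

/-- Multiplying by a matrix and taking directions only depends on the direction of the vector. -/
theorem normalize_vecMul_normalize {n d : ℕ} (a : Fin n → ℝ) (X : Matrix (Fin n) (Fin d) ℝ) :
    (euclNorm (((euclNorm a)⁻¹ • a) ᵥ* X))⁻¹ • (((euclNorm a)⁻¹ • a) ᵥ* X) =
      (euclNorm (a ᵥ* X))⁻¹ • (a ᵥ* X) := by
  rcases eq_or_ne a 0 with rfl | ha
  · simp
  · rw [Matrix.smul_vecMul, normalize_smul (inv_pos.2 (euclNorm_pos ha))]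

theorem tendsto_normalize {α : Type*} {l : Filter α} {d : ℕ} {f : α → Fin d → ℝ}
    {x : Fin d → ℝ} (hf : Tendsto f l (𝓝 x)) (hx : x ≠ 0) :
    Tendsto (fun k => (euclNorm (f k))⁻¹ • f k) l (𝓝 ((euclNorm x)⁻¹ • x)) :=
  (((continuous_euclNorm.tendsto x).comp hf).inv₀ (euclNorm_pos hx).ne').smul hf

theorem rowProj_eq_Dmat_mul {n d : ℕ} (γbar : Fin n → (Fin d → ℝ) → ℝ)
    (B : Matrix (Fin n) (Fin d) ℝ) : rowProj γbar B = Dmat γbar B * B := by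
  ext i j
  simp only [rowProj, radialProj, Dmat, Matrix.diagonal_mul, Matrix.of_apply, Pi.smul_apply,
    smul_eq_mul]
  ring

theorem traj_eq_Atilde_mul {n d : ℕ} (A : Matrix (Fin n) (Fin n) ℝ)
    (γbar : Fin n → (Fin d → ℝ) → ℝ) (X₀ : Matrix (Fin n) (Fin d) ℝ) (k : ℕ) :
    traj A γbar X₀ k = Atilde A γbar X₀ k * X₀ := by
  induction k with
  | zero => simp [traj, Atilde]
  | succ k ih =>
    rw [traj, Atilde, rowProj_eq_Dmat_mul, Matrix.mul_assoc, Matrix.mul_assoc,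
      ← ih]

theorem vecMul_ne_zero_of_pos {n d : ℕ} {v : Fin n → ℝ} (hv : ∀ i, 0 < v i)
    {X : Matrix (Fin n) (Fin d) ℝ} {h : Fin d → ℝ} (hnn : ∀ i, 0 ≤ (X *ᵥ h) i)
    (hnz : X *ᵥ h ≠ 0) : v ᵥ* X ≠ 0 := by
  intro h0
  have hdot : v ⬝ᵥ (X *ᵥ h) = 0 := by rw [Matrix.dotProduct_mulVec, h0, zero_dotProduct]
  rw [dotProduct, Finset.sum_eq_zero_iff_of_nonneg
    fun i _ => mul_nonneg (hv i).le (hnn i)] at hdot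
  exact hnz (funext fun i =>
    (mul_eq_zero.1 (hdot i (Finset.mem_univ i))).resolve_left (hv i).ne')

theorem ConsensusPW.consensusDir {n d : ℕ} {X : ℕ → Matrix (Fin n) (Fin d) ℝ}
    (hX : ConsensusPW X) : ConsensusDir X := by
  obtain ⟨u, -, hu⟩ := hX
  intro i j
  have hlim := (continuous_euclNorm.tendsto (u - u)).comp ((hu i).sub (hu j))
  rwa [sub_self, euclNorm_eq_zero.2 rfl] at hlim

theorem stmt16 {n d : ℕ} (hn : 1 ≤ n) (hd : 1 ≤ d)
    (A : Matrix (Fin n) (Fin n) ℝ) (γbar : Fin n → (Fin d → ℝ) → ℝ)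
    (hA : Assumption2 A γbar)
    (X₀ : Matrix (Fin n) (Fin d) ℝ) (hX₀ : X₀ ∈ Sset n d γbar)
    (v : Fin n → ℝ) (hv : IsLimitVec A γbar X₀ v)
    (h : Fin d → ℝ) (hh : euclNorm h = 1)
    (hnn : ∀ i, 0 ≤ Matrix.mulVec X₀ h i)
    (hnz : Matrix.mulVec X₀ h ≠ (0 : Fin n → ℝ)) :
    Matrix.vecMul v X₀ ≠ (0 : Fin d → ℝ) ∧
      ConsensusDir (traj A γbar X₀) ∧ ConsensusPW (traj A γbar X₀) := by
  have hne := vecMul_ne_zero_of_pos hv.2.1 hnn hnz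
  have hpw : ConsensusPW (traj A γbar X₀) := by
    refine ⟨_, euclNorm_normalize hne, fun i => ?_⟩
    have hcont : Continuous fun a : Fin n → ℝ => a ᵥ* X₀ :=
      continuous_id.matrix_vecMul continuous_const
    refine (tendsto_normalize ((hcont.tendsto v).comp (hv.2.2 i)) hne).congr fun k => ?_
    rw [traj_eq_Atilde_mul]
    exact normalize_vecMul_normalize (Atilde A γbar X₀ k i) X₀
  exact ⟨hne, hpw.consensusDir, hpw⟩
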